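/- Let G be a finite connected distance-hereditary graph and let x,y be a mutually distant pair of vertices. For every vertex u of G: max{d(x,u), d(y,u)} ≤ e(u), and e(u) ≤ max{d(x,u), d(y,u)} + c, where c = 0 if |d(x,u) − d(y,u)| ≥ 2; c = 1 if |d(x,u) − d(y,u)| = 1 or d(x,y) is odd; and c = 2 otherwise. -/

import Mathlib

/-- A graph is distance-hereditary if every connected induced subgraph is isometric
(equivalently, every induced path is a shortest path). -/
def DistHereditary {V : Type*} (G : SimpleGraph V) : Prop :=
  ∀ s : Set V, (G.induce s).Connected →
    ∀ u v : s, (G.induce s).dist u v = G.dist (u : V) (v : V)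

/-- Eccentricity of a vertex: `e(v) = max_{u} d(v,u)`. -/
noncomputable def ecc {V : Type*} [Fintype V] (G : SimpleGraph V) (v : V) : ℕ :=
  Finset.univ.sup (fun u => G.dist v u)

/-- Radius: minimum eccentricity. -/
noncomputable def rad {V : Type*} [Fintype V] (G : SimpleGraph V) : ℕ :=
  sInf (Set.range (ecc G))

/-- Diameter: maximum eccentricity. -/
noncomputable def diam {V : Type*} [Fintype V] (G : SimpleGraph V) : ℕ :=
  Finset.univ.sup (fun v => ecc G v)

/-- The center: vertices of minimum eccentricity. -/
def center {V : Type*} [Fintype V] (G : SimpleGraph V) : Set V :=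
  {v | ecc G v = rad G}

/-- Distance from a vertex to a set of vertices: `d(v,S) = min_{s ∈ S} d(v,s)`. -/
noncomputable def distToSet {V : Type*} (G : SimpleGraph V) (v : V) (S : Set V) : ℕ :=
  sInf ((G.dist v) '' S)

/-- The interval `I(x,y)`: vertices on shortest `(x,y)`-paths. -/
def interval {V : Type*} (G : SimpleGraph V) (x y : V) : Set V :=
  {v | G.dist x v + G.dist v y = G.dist x y}

/-- The intervalSlice `S_k(x,y) = {v ∈ I(x,y) : d(x,v) = k}`. -/
def intervalSlice {V : Type*} (G : SimpleGraph V) (x y : V) (k : ℕ) : Set V :=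
  {v | v ∈ interval G x y ∧ G.dist x v = k}

/-- The set `S` induces a cograph in `G`: no induced path on four vertices within `S`. -/
def IsCographOn {V : Type*} (G : SimpleGraph V) (S : Set V) : Prop :=
  ¬ ∃ a b c d : V, a ∈ S ∧ b ∈ S ∧ c ∈ S ∧ d ∈ S ∧
    a ≠ c ∧ a ≠ d ∧ b ≠ d ∧
    G.Adj a b ∧ G.Adj b c ∧ G.Adj c d ∧ ¬ G.Adj a c ∧ ¬ G.Adj a d ∧ ¬ G.Adj b d

namespace SimpleGraph

variable {V : Type*} {G : SimpleGraph V}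

/-- A vertex on a geodesic splits it additively and is determined by its distance to the start. -/
lemma Connected.dist_add_dist_of_mem_geodesic (hconn : G.Connected) {a b v : V} (p : G.Walk a b)
    (hp : p.length = G.dist a b) (hv : v ∈ p.support) :
    G.dist a v + G.dist v b = G.dist a b ∧ p.getVert (G.dist a v) = v := by
  obtain ⟨n, rfl, hn⟩ := Walk.mem_support_iff_exists_getVert.mp hv
  have h₁ := dist_le (p.take n)
  have h₂ := dist_le (p.drop n)
  rw [Walk.take_length] at h₁
  rw [Walk.drop_length] at h₂
  have h₃ := hconn.dist_triangle (u := a) (v := p.getVert n) (w := b)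
  have h₄ : G.dist a (p.getVert n) = n := by omega
  exact ⟨by omega, by rw [h₄]⟩

/-- A walk crossing from `L` to `R`, when all contact between `L` and `R` goes through `w`, is at
least as long as the detour through `w`. -/
lemma Connected.dist_add_dist_le_length_of_separates (hconn : G.Connected) {L R : Set V} {w : V}
    (hwL : w ∈ L) (hinter : L ∩ R ⊆ {w})
    (hadj : ∀ p ∈ L, ∀ q ∈ R, G.Adj p q → p = w ∨ q = w) {a b : V} (p : G.Walk a b)
    (hp : ∀ v ∈ p.support, v ∈ L ∪ R) (ha : a ∈ L) (hb : b ∈ R) :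
    G.dist a w + G.dist w b ≤ p.length := by
  induction p with
  | nil =>
    obtain rfl : _ = w := hinter ⟨ha, hb⟩
    simp
  | @cons a c b h p ih =>
    have hp' : ∀ v ∈ p.support, v ∈ L ∪ R := fun v hv => hp v (by simp [hv])
    have hstep : c ∈ L → G.dist a w + G.dist w b ≤ (Walk.cons h p).length := fun hc => by
      have h₁ := ih hp' hc hb
      have h₂ := hconn.dist_triangle (u := a) (v := c) (w := w)
      have h₃ := dist_eq_one_iff_adj.mpr h
      rw [Walk.length_cons]
      omega
    rcases hp' c p.start_mem_support with hc | hc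
    · exact hstep hc
    · rcases hadj a ha c hc h with rfl | rfl
      · simpa using dist_le (Walk.cons h p)
      · exact hstep hwL

end SimpleGraph

namespace DistHereditary

open SimpleGraph

variable {V : Type*} {G : SimpleGraph V}

lemma exists_geodesic_in (hdh : DistHereditary G) {s : Set V} (hs : (G.induce s).Connected)
    {a b : V} (ha : a ∈ s) (hb : b ∈ s) :
    ∃ p : G.Walk a b, p.length = G.dist a b ∧ ∀ v ∈ p.support, v ∈ s := by
  obtain ⟨p, hp⟩ := hs.exists_walk_length_eq_dist ⟨a, ha⟩ ⟨b, hb⟩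
  refine ⟨p.map (Embedding.induce s).toHom, ?_, ?_⟩
  · exact (Walk.length_map _ p).trans (hp.trans (hdh s hs _ _))
  · intro v hv
    obtain ⟨z, -, rfl⟩ := List.mem_map.mp ((Walk.support_map _ p) ▸ hv)
    exact z.2

/-- If two connected sets touch only through a common vertex `w`, then distances across add up
at `w`. -/
lemma dist_eq_of_separates (hdh : DistHereditary G) (hconn : G.Connected) {L R : Set V} {w : V}
    (hL : (G.induce L).Connected) (hR : (G.induce R).Connected) (hwL : w ∈ L) (hwR : w ∈ R)
    (hinter : L ∩ R ⊆ {w}) (hadj : ∀ p ∈ L, ∀ q ∈ R, G.Adj p q → p = w ∨ q = w) {a b : V}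
    (ha : a ∈ L) (hb : b ∈ R) : G.dist a b = G.dist a w + G.dist w b := by
  obtain ⟨p, hp, hps⟩ := hdh.exists_geodesic_in
    (induce_union_connected hL.preconnected hR.preconnected ⟨w, hwL, hwR⟩) (Or.inl ha) (Or.inr hb)
  have := hconn.dist_add_dist_le_length_of_separates hwL hinter hadj p hps ha hb
  exact le_antisymm hconn.dist_triangle (by omega)

lemma dist_add_dist_eq_of_separates (hdh : DistHereditary G) (hconn : G.Connected) {L R : Set V}
    {w : V} (hL : (G.induce L).Connected) (hR : (G.induce R).Connected) (hwL : w ∈ L)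
    (hwR : w ∈ R) (hinter : L ∩ R ⊆ {w})
    (hadj : ∀ p ∈ L, ∀ q ∈ R, G.Adj p q → p = w ∨ q = w) {a b c d : V}
    (ha : a ∈ L) (hc : c ∈ L) (hb : b ∈ R) (hd : d ∈ R) :
    G.dist a b + G.dist c d = G.dist a d + G.dist b c := by
  have key {u v : V} (hu : u ∈ L) (hv : v ∈ R) :=
    hdh.dist_eq_of_separates hconn hL hR hwL hwR hinter hadj hu hv
  rw [key ha hb, key hc hd, key ha hd, G.dist_comm (u := b), key hc hb]
  omega

lemma disjoint_geodesics (hconn : G.Connected) {a b c d : V}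
    (h : G.dist a c + G.dist b d < G.dist a b + G.dist c d)
    (p : G.Walk a c) (hp : p.length = G.dist a c) (q : G.Walk b d) (hq : q.length = G.dist b d)
    {v : V} (hvp : v ∈ p.support) : v ∉ q.support := by
  intro hvq
  have h₁ := (hconn.dist_add_dist_of_mem_geodesic p hp hvp).1
  have h₂ := (hconn.dist_add_dist_of_mem_geodesic q hq hvq).1
  have h₃ := hconn.dist_triangle (u := a) (v := v) (w := b)
  have h₄ := hconn.dist_triangle (u := c) (v := v) (w := d)
  rw [G.dist_comm (u := v) (v := b)] at h₃
  rw [G.dist_comm (u := c) (v := v)] at h₄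
  omega

/-- If `d(a,b) + d(c,d)` is the strictly largest of the three distance sums, then any geodesics
from `a` to `c` and from `b` to `d` are joined by an edge. -/
lemma exists_adj_geodesics (hdh : DistHereditary G) (hconn : G.Connected) {a b c d : V}
    (h₁ : G.dist a c + G.dist b d < G.dist a b + G.dist c d)
    (h₂ : G.dist a d + G.dist b c < G.dist a b + G.dist c d)
    (p : G.Walk a c) (hp : p.length = G.dist a c) (q : G.Walk b d) (hq : q.length = G.dist b d) :
    ∃ s ∈ p.support, ∃ t ∈ q.support, G.Adj s t := by
  by_contra! hno
  obtain ⟨⟨m, n⟩, ⟨hm, hn⟩, hmin⟩ := Set.exists_min_image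
    ({v | v ∈ p.support} ×ˢ {v | v ∈ q.support}) (fun z => G.dist z.1 z.2)
    ((List.finite_toSet p.support).prod (List.finite_toSet q.support))
    ⟨(a, b), p.start_mem_support, q.start_mem_support⟩
  simp only [Set.mem_ofPred_eq] at hm hn
  have hmin' : ∀ v ∈ p.support, G.dist m n ≤ G.dist v n := fun v hv => hmin (v, n) ⟨hv, hn⟩
  obtain ⟨r, hr⟩ := hconn.exists_walk_length_eq_dist m n
  cases r with
  | nil => exact disjoint_geodesics hconn h₁ p hp q hq hm hn
  | @cons _ w _ hmw r =>
    rw [Walk.length_cons] at hr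
    have hrw : r.length = G.dist w n := by
      have := hconn.dist_triangle (u := m) (v := w) (w := n)
      have := dist_eq_one_iff_adj.mpr hmw
      have := dist_le r
      omega
    have hrdist : ∀ v ∈ r.support, G.dist w v + G.dist v n + 1 = G.dist m n := fun v hv => by
      have := (hconn.dist_add_dist_of_mem_geodesic r hrw hv).1
      omega
    have heq := hdh.dist_add_dist_eq_of_separates hconn (a := a) (b := b) (c := c) (d := d)
      (L := {v | v ∈ p.support} ∪ {m, w}) (R := {v | v ∈ q.support} ∪ {v | v ∈ r.support}) (w := w)
      (induce_union_connected p.connected_induce_support.preconnected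
        (induce_pair_connected_of_adj hmw).preconnected ⟨m, hm, by simp⟩)
      (induce_union_connected q.connected_induce_support.preconnected
        r.connected_induce_support.preconnected ⟨n, hn, r.end_mem_support⟩)
      (by simp) (Or.inr r.start_mem_support) ?_ ?_
      (Or.inl p.start_mem_support) (Or.inl p.end_mem_support)
      (Or.inl q.start_mem_support) (Or.inl q.end_mem_support)
    · omega
    · rintro v ⟨hvL, hvR⟩
      by_contra hvw
      have hvp : v ∈ p.support := by
        rcases hvL with hv | rfl | hv
        · exact hv
        · exact hm
        · exact absurd hv hvw
      rcases hvR with hv | hv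
      · exact disjoint_geodesics hconn h₁ p hp q hq hvp hv
      · have := hmin' v hvp
        have := hrdist v hv
        omega
    · intro s hs t ht hst
      by_contra! hne
      have hsp : s ∈ p.support := by
        rcases hs with hs | rfl | hs
        · exact hs
        · exact hm
        · exact absurd hs hne.1
      rcases ht with ht | ht
      · exact hno s hsp t ht hst
      · have := hmin' s hsp
        have := hrdist t ht
        have := hconn.dist_triangle (u := s) (v := t) (w := n)
        have := dist_eq_one_iff_adj.mpr hst
        have := hconn.pos_dist_of_ne hne.2.symm
        omega

lemma dist_add_dist_le_add_two (hdh : DistHereditary G) (hconn : G.Connected) {a b c d : V}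
    (h₁ : G.dist a c + G.dist b d < G.dist a b + G.dist c d)
    (h₂ : G.dist a d + G.dist b c < G.dist a b + G.dist c d) :
    G.dist a b + G.dist c d ≤ G.dist a c + G.dist b d + 2 := by
  obtain ⟨p, hp⟩ := hconn.exists_walk_length_eq_dist a c
  obtain ⟨q, hq⟩ := hconn.exists_walk_length_eq_dist b d
  obtain ⟨s, hs, t, ht, hst⟩ := hdh.exists_adj_geodesics hconn h₁ h₂ p hp q hq
  have := (hconn.dist_add_dist_of_mem_geodesic p hp hs).1
  have := (hconn.dist_add_dist_of_mem_geodesic q hq ht).1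
  have := dist_eq_one_iff_adj.mpr hst
  have := hconn.dist_triangle (u := a) (v := s) (w := b)
  have := hconn.dist_triangle (u := s) (v := t) (w := b)
  have := hconn.dist_triangle (u := c) (v := s) (w := d)
  have := hconn.dist_triangle (u := s) (v := t) (w := d)
  have := G.dist_comm (u := c) (v := s)
  have := G.dist_comm (u := t) (v := b)
  omega

lemma dist_add_dist_le_of_lt (hdh : DistHereditary G) (hconn : G.Connected) {a b c d : V}
    (h₁ : G.dist a c + G.dist b d < G.dist a b + G.dist c d)
    (h₂ : G.dist a d + G.dist b c < G.dist a b + G.dist c d) :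
    G.dist a c + G.dist b d ≤ G.dist a d + G.dist b c := by
  by_contra! hlt
  have hcd := G.dist_comm (u := c) (v := d)
  obtain ⟨p, hp⟩ := hconn.exists_walk_length_eq_dist a d
  obtain ⟨q, hq⟩ := hconn.exists_walk_length_eq_dist b c
  have hle := hdh.dist_add_dist_le_add_two hconn (a := a) (b := b) (c := d) (d := c)
    (by omega) (by omega)
  obtain ⟨s, hs, t, ht, hst⟩ := hdh.exists_adj_geodesics hconn (a := a) (b := b) (c := d) (d := c)
    (by omega) (by omega) p hp q hq
  have tight : ∀ s ∈ p.support, ∀ t ∈ q.support, G.Adj s t →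
      G.dist a b = G.dist a s + 1 + G.dist b t ∧
      G.dist a c ≤ G.dist a s + 1 + (G.dist b c - G.dist b t) ∧ G.dist b t ≤ G.dist b c ∧
      G.dist b d ≤ G.dist b t + 1 + (G.dist a d - G.dist a s) ∧ G.dist a s ≤ G.dist a d := by
    intro s hs t ht hst
    have := (hconn.dist_add_dist_of_mem_geodesic p hp hs).1
    have := (hconn.dist_add_dist_of_mem_geodesic q hq ht).1
    have := dist_eq_one_iff_adj.mpr hst
    have := hconn.dist_triangle (u := a) (v := s) (w := b)
    have := hconn.dist_triangle (u := s) (v := t) (w := b)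
    have := hconn.dist_triangle (u := c) (v := t) (w := d)
    have := hconn.dist_triangle (u := t) (v := s) (w := d)
    have := hconn.dist_triangle (u := a) (v := s) (w := c)
    have := hconn.dist_triangle (u := s) (v := t) (w := c)
    have := hconn.dist_triangle (u := b) (v := t) (w := d)
    have := G.dist_comm (u := c) (v := t)
    have := G.dist_comm (u := t) (v := b)
    have := G.dist_comm (u := t) (v := s)
    omega
  have hunique : ∀ s' ∈ p.support, ∀ t' ∈ q.support, G.Adj s' t' → s' = s := by
    intro s' hs' t' ht' hst'
    have := tight s hs t ht hst
    have := tight s' hs' t' ht' hst'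
    have heq : G.dist a s' = G.dist a s := by omega
    rw [← (hconn.dist_add_dist_of_mem_geodesic p hp hs).2,
      ← (hconn.dist_add_dist_of_mem_geodesic p hp hs').2, heq]
  have hdisj := fun v (hv : v ∈ p.support) =>
    disjoint_geodesics hconn (a := a) (b := b) (c := d) (d := c) (by omega) p hp q hq hv
  have heq := hdh.dist_add_dist_eq_of_separates hconn (a := a) (b := b) (c := d) (d := c)
    (L := {v | v ∈ p.support}) (R := {v | v ∈ q.support} ∪ {t, s}) (w := s)
    p.connected_induce_support
    (induce_union_connected q.connected_induce_support.preconnected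
      (induce_pair_connected_of_adj hst.symm).preconnected ⟨t, ht, by simp⟩)
    hs (by simp) ?_ ?_ p.start_mem_support p.end_mem_support
    (Or.inl q.start_mem_support) (Or.inl q.end_mem_support)
  · omega
  · rintro v ⟨hvp, hv | rfl | hv⟩
    · exact absurd hv (hdisj v hvp)
    · exact absurd ht (hdisj v hvp)
    · exact hv
  · rintro u hu v (hv | rfl | hv) huv
    · exact Or.inl (hunique u hu v hv huv)
    · exact Or.inl (hunique u hu v ht huv)
    · exact Or.inr hv

/-- Four-point condition: if one of the three distance sums of four vertices is strictly largest,
then the other two agree and it exceeds them by at most two. -/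
theorem four_point (hdh : DistHereditary G) (hconn : G.Connected) {a b c d : V}
    (h₁ : G.dist a c + G.dist b d < G.dist a b + G.dist c d)
    (h₂ : G.dist a d + G.dist b c < G.dist a b + G.dist c d) :
    G.dist a c + G.dist b d = G.dist a d + G.dist b c ∧
      G.dist a b + G.dist c d ≤ G.dist a c + G.dist b d + 2 := by
  refine ⟨le_antisymm (hdh.dist_add_dist_le_of_lt hconn h₁ h₂) ?_,
    hdh.dist_add_dist_le_add_two hconn h₁ h₂⟩
  rw [G.dist_comm (u := c)] at h₁ h₂
  exact hdh.dist_add_dist_le_of_lt hconn h₂ h₁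

/-- If `x, y, v` are pairwise at the same odd distance, then no vertex is equidistant from `x`
and `y` and farther by two from `v`. -/
lemma not_odd_equidistant (hdh : DistHereditary G) (hconn : G.Connected) {x y u v : V}
    (hodd : Odd (G.dist x y)) (hxv : G.dist x v = G.dist x y) (hyv : G.dist y v = G.dist x y)
    (hu : G.dist x u = G.dist y u) : G.dist u v ≠ G.dist x u + 2 := by
  intro huv
  obtain ⟨h, hh⟩ := hodd
  obtain ⟨p, hp⟩ := hconn.exists_walk_length_eq_dist x y
  obtain ⟨m, hxm, hmy⟩ : ∃ m, G.dist x m = h ∧ G.dist m y = h + 1 := by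
    have h₁ := dist_le (p.take h)
    have h₂ := dist_le (p.drop h)
    rw [Walk.take_length] at h₁
    rw [Walk.drop_length] at h₂
    have h₃ := (hconn.dist_add_dist_of_mem_geodesic p hp (p.getVert_mem_support h)).1
    exact ⟨p.getVert h, by omega, by omega⟩
  have hmv : G.dist m v ≤ h + 1 := by
    by_contra! hlt
    have := (hdh.four_point hconn (a := x) (b := y) (c := m) (d := v) (by omega)
      (by rw [G.dist_comm (u := y)]; omega)).1
    rw [G.dist_comm (u := y) (v := m)] at this
    omega
  have := hconn.dist_triangle (u := u) (v := m) (w := v)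
  have := G.dist_comm (u := u) (v := m)
  have := G.dist_comm (u := y) (v := m)
  have := (hdh.four_point hconn (a := x) (b := y) (c := m) (d := u) (by omega) (by omega)).1
  omega

end DistHereditary

lemma dist_le_ecc {V : Type*} [Fintype V] (G : SimpleGraph V) (u v : V) : G.dist u v ≤ ecc G u :=
  Finset.le_sup (f := fun u' => G.dist u u') (Finset.mem_univ v)

lemma exists_dist_eq_ecc {V : Type*} [Fintype V] (G : SimpleGraph V) (u : V) :
    ∃ v, G.dist u v = ecc G u := by
  obtain ⟨v, -, hv⟩ := Finset.exists_mem_eq_sup Finset.univ ⟨u, Finset.mem_univ u⟩ (G.dist u)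
  exact ⟨v, hv.symm⟩

/-- Let `x,y` be mutually distant. For every vertex `u`:
`max{d(x,u), d(y,u)} ≤ e(u)`, and `e(u) ≤ max{d(x,u), d(y,u)} + c` where
`c = 0` if `|d(x,u) − d(y,u)| ≥ 2`, `c = 1` if `|d(x,u) − d(y,u)| = 1` or `d(x,y)` is odd,
and `c = 2` otherwise. -/
theorem all_bounds {V : Type*} [Fintype V] (G : SimpleGraph V)
    (hconn : G.Connected) (hdh : DistHereditary G) (x y : V)
    (hxy : G.dist x y = ecc G x) (hyx : G.dist y x = ecc G y) :
    ∀ u : V,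
      max (G.dist x u) (G.dist y u) ≤ ecc G u ∧
      ((2 : ℤ) ≤ |(G.dist x u : ℤ) - (G.dist y u : ℤ)| →
        ecc G u ≤ max (G.dist x u) (G.dist y u)) ∧
      ((|(G.dist x u : ℤ) - (G.dist y u : ℤ)| = 1 ∨ Odd (G.dist x y)) →
        ecc G u ≤ max (G.dist x u) (G.dist y u) + 1) ∧
      ecc G u ≤ max (G.dist x u) (G.dist y u) + 2 := by
  intro u
  obtain ⟨v, hv⟩ := exists_dist_eq_ecc G u
  have hxu := dist_le_ecc G u x
  have hyu := dist_le_ecc G u y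
  have hxv := dist_le_ecc G x v
  have hyv := dist_le_ecc G y v
  rw [G.dist_comm] at hxu hyu hyx
  have hbound : max (G.dist x u) (G.dist y u) < ecc G u →
      G.dist x u + G.dist y v = G.dist x v + G.dist y u ∧
        G.dist x y + G.dist u v ≤ G.dist x u + G.dist y v + 2 := fun hlt => by
    rw [max_lt_iff] at hlt
    exact hdh.four_point hconn (by omega) (by omega)
  refine ⟨max_le hxu hyu, fun hdiff => ?_, fun hcase => ?_, ?_⟩
  · by_contra! hlt
    have := hbound hlt
    rw [max_lt_iff] at hlt
    rw [le_abs] at hdiff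
    omega
  · by_contra! hlt
    have := hbound (by omega)
    rcases hcase with hdiff | hodd
    · rw [abs_eq zero_le_one] at hdiff
      omega
    · exact hdh.not_odd_equidistant hconn (u := u) (v := v) hodd (by omega) (by omega) (by omega)
        (by omega)
  · by_contra! hlt
    have := hbound (by omega)
    omega
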